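/- arXiv:1002.1769 — 3 statements merged into one kernel-verified Lean document; each statement's English description precedes it below -/
import Mathlib

section
/- Let w : ℝ × ℝ → ℝ be a smooth function of (y,τ) with w_y > 0 everywhere, satisfying the Schwarzian KdV equation w_τ = −( w_yyy − (3/2)·w_yy²/w_y ) at every point. Then the function v := −∂_y log w_y = −w_yy / w_y satisfies the MKdV equation v_τ = −v_yyy + (3/2) v² v_y at every point. -/
/-- Partial derivative with respect to the first variable (y). -/
noncomputable def pdy (f : ℝ × ℝ → ℝ) : ℝ × ℝ → ℝ := fun p => deriv (fun y => f (y, p.2)) p.1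

/-- Partial derivative with respect to the second variable (τ). -/
noncomputable def pdtau (f : ℝ × ℝ → ℝ) : ℝ × ℝ → ℝ := fun p => deriv (fun t => f (p.1, t)) p.2

open scoped ContDiff

theorem hasDerivAt_fst_slice {f : ℝ × ℝ → ℝ} {p : ℝ × ℝ} (hf : DifferentiableAt ℝ f p) :
    HasDerivAt (fun y => f (y, p.2)) (fderiv ℝ f p (1, 0)) p.1 :=
  HasFDerivAt.comp_hasDerivAt p.1 (f := fun y : ℝ => (y, p.2)) hf.hasFDerivAt
    ((hasDerivAt_id p.1).prodMk (hasDerivAt_const p.1 p.2))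

theorem hasDerivAt_snd_slice {f : ℝ × ℝ → ℝ} {p : ℝ × ℝ} (hf : DifferentiableAt ℝ f p) :
    HasDerivAt (fun t => f (p.1, t)) (fderiv ℝ f p (0, 1)) p.2 :=
  HasFDerivAt.comp_hasDerivAt p.2 (f := fun t : ℝ => (p.1, t)) hf.hasFDerivAt
    ((hasDerivAt_const p.2 p.1).prodMk (hasDerivAt_id p.2))

theorem pdy_eq_fderiv {f : ℝ × ℝ → ℝ} (hf : Differentiable ℝ f) :
    pdy f = fun p => fderiv ℝ f p (1, 0) :=
  funext fun p => (hasDerivAt_fst_slice (hf p)).deriv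

theorem pdtau_eq_fderiv {f : ℝ × ℝ → ℝ} (hf : Differentiable ℝ f) :
    pdtau f = fun p => fderiv ℝ f p (0, 1) :=
  funext fun p => (hasDerivAt_snd_slice (hf p)).deriv

theorem contDiff_pdy {f : ℝ × ℝ → ℝ} (hf : ContDiff ℝ ∞ f) : ContDiff ℝ ∞ (pdy f) := by
  rw [pdy_eq_fderiv (hf.differentiable (by simp))]
  exact (hf.fderiv_right (m := ∞) (by simp)).clm_apply contDiff_const

theorem pdtau_pdy_comm {f : ℝ × ℝ → ℝ} (hf : ContDiff ℝ ∞ f) :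
    pdtau (pdy f) = pdy (pdtau f) := by
  have hd : Differentiable ℝ (fderiv ℝ f) :=
    (hf.fderiv_right (m := ∞) (by simp)).differentiable (by simp)
  have hd' (u : ℝ × ℝ) : Differentiable ℝ fun p => fderiv ℝ f p u :=
    hd.clm_apply (differentiable_const u)
  have hf' : Differentiable ℝ f := hf.differentiable (by simp)
  rw [pdy_eq_fderiv hf', pdtau_eq_fderiv hf', pdtau_eq_fderiv (hd' _), pdy_eq_fderiv (hd' _)]
  funext p
  have hsymm : IsSymmSndFDerivAt ℝ f p :=
    hf.contDiffAt.isSymmSndFDerivAt (by simpa using WithTop.coe_le_coe.2 (le_top (a := (2 : ℕ∞))))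
  rw [fderiv_clm_apply (hd p) (differentiableAt_const _),
    fderiv_clm_apply (hd p) (differentiableAt_const _)]
  simpa using hsymm.eq (0, 1) (1, 0)

theorem pdy_mul {f g : ℝ × ℝ → ℝ} (hf : Differentiable ℝ f) (hg : Differentiable ℝ g) :
    pdy (fun p => f p * g p) = fun p => pdy f p * g p + f p * pdy g p := by
  rw [pdy_eq_fderiv (hf.fun_mul hg), pdy_eq_fderiv hf, pdy_eq_fderiv hg]
  funext p
  rw [fderiv_fun_mul (hf p) (hg p)]
  simp
  ring

theorem pdtau_mul {f g : ℝ × ℝ → ℝ} (hf : Differentiable ℝ f) (hg : Differentiable ℝ g) :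
    pdtau (fun p => f p * g p) = fun p => pdtau f p * g p + f p * pdtau g p := by
  rw [pdtau_eq_fderiv (hf.fun_mul hg), pdtau_eq_fderiv hf, pdtau_eq_fderiv hg]
  funext p
  rw [fderiv_fun_mul (hf p) (hg p)]
  simp
  ring

theorem pdy_add {f g : ℝ × ℝ → ℝ} (hf : Differentiable ℝ f) (hg : Differentiable ℝ g) :
    pdy (fun p => f p + g p) = fun p => pdy f p + pdy g p := by
  rw [pdy_eq_fderiv (hf.fun_add hg), pdy_eq_fderiv hf, pdy_eq_fderiv hg]
  funext p
  rw [fderiv_fun_add (hf p) (hg p)]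
  simp

theorem pdy_const_mul (c : ℝ) (f : ℝ × ℝ → ℝ) :
    pdy (fun p => c * f p) = fun p => c * pdy f p := by
  funext p
  simp [pdy]

theorem pdtau_const_mul (c : ℝ) (f : ℝ × ℝ → ℝ) :
    pdtau (fun p => c * f p) = fun p => c * pdtau f p := by
  funext p
  simp [pdtau]

/-- If `w` solves the Schwarzian KdV equation `w_τ = −(w_yyy − (3/2) w_yy²/w_y)`, then
`v = −w_yy/w_y` (the Cole–Hopf transform of `w_y`) solves the MKdV equation
`v_τ = −v_yyy + (3/2) v² v_y`. -/
theorem schwarzianKdV_to_mkdv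
    (w v : ℝ × ℝ → ℝ) (hw : ContDiff ℝ (⊤ : ℕ∞) w) (hwy : ∀ p, 0 < pdy w p)
    (hSKdV : ∀ p : ℝ × ℝ,
      pdtau w p = -(pdy (pdy (pdy w)) p - (3 / 2) * (pdy (pdy w) p) ^ 2 / pdy w p))
    (hv : v = fun p => -(pdy (pdy w) p) / pdy w p) :
    ∀ p : ℝ × ℝ,
      pdtau v p = -pdy (pdy (pdy v)) p + (3 / 2) * (v p) ^ 2 * pdy v p := by
  have ha : ContDiff ℝ ∞ (pdy w) := contDiff_pdy hw
  have hne (p : ℝ × ℝ) : pdy w p ≠ 0 := (hwy p).ne'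
  have hv0 : ContDiff ℝ ∞ v := hv ▸ (contDiff_pdy ha).neg.div ha hne
  have hdv0 : Differentiable ℝ v := hv0.differentiable (by simp)
  have hdv1 : Differentiable ℝ (pdy v) := (contDiff_pdy hv0).differentiable (by simp)
  have hdv2 : Differentiable ℝ (pdy (pdy v)) := (contDiff_pdy (contDiff_pdy hv0)).differentiable (by simp)
  have hwyy : pdy (pdy w) = fun p => -1 * (v p * pdy w p) := by
    funext p
    have := hne p
    simp only [hv]
    field_simp
  have hda : Differentiable ℝ (pdy w) := ha.differentiable (by simp)
  have hwyyy : pdy (pdy (pdy w)) =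
      fun p => -1 * (pdy v p * pdy w p + v p * (-1 * (v p * pdy w p))) := by
    rw [hwyy, pdy_const_mul, pdy_mul hdv0 hda, hwyy]
  have hvv : Differentiable ℝ fun p => v p * v p := hdv0.fun_mul hdv0
  have hwt : pdtau w = fun p => pdy w p * (pdy v p + 1 / 2 * (v p * v p)) := by
    funext p
    have := hne p
    rw [hSKdV p, hwyyy, hwyy]
    field_simp
    ring
  have hwyt : pdtau (pdy w) =
      fun p => pdy w p * (pdy (pdy v) p + -1 / 2 * (v p * (v p * v p))) := by
    rw [pdtau_pdy_comm hw, hwt, pdy_mul hda (hdv1.fun_add (hvv.const_mul _)),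
      pdy_add hdv1 (hvv.const_mul _), pdy_const_mul, pdy_mul hdv0 hdv0, hwyy]
    funext p
    ring
  have hvvv : Differentiable ℝ fun p => v p * (v p * v p) := hdv0.fun_mul hvv
  have hwyyt : pdtau (pdy (pdy w)) = pdy (pdtau (pdy w)) := pdtau_pdy_comm ha
  rw [hwyt, pdy_mul hda (hdv2.fun_add (hvvv.const_mul _)), pdy_add hdv2 (hvvv.const_mul _),
    pdy_const_mul, pdy_mul hdv0 hvv, pdy_mul hdv0 hdv0, hwyy, pdtau_const_mul,
    pdtau_mul hdv0 hda, hwyt] at hwyyt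
  intro p
  have h := congrFun hwyyt p
  refine mul_right_cancel₀ (hne p) ?_
  linear_combination -h
end

section
/- Let w : ℝ × ℝ → ℝ be a smooth function of (x,t) satisfying the Fordy–Gibbons equation w_t = w_xxxxx − 5 w_x w_xxx − 5 w_xx² − 5 w_x³ − 20 w w_x w_xx − 5 w² w_xxx + 5 w⁴ w_x at every point. Then the function u := w_x − w² satisfies the Sawada–Kotera equation u_t = u_xxxxx + 5 u u_xxx + 5 u_x u_xx + 5 u² u_x at every point. -/
/-- Partial derivative with respect to the first variable (x). -/
noncomputable def pdx (f : ℝ × ℝ → ℝ) : ℝ × ℝ → ℝ := fun p => deriv (fun x => f (x, p.2)) p.1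

/-- Partial derivative with respect to the second variable (t). -/
noncomputable def pdt (f : ℝ × ℝ → ℝ) : ℝ × ℝ → ℝ := fun p => deriv (fun t => f (p.1, t)) p.2

open scoped ContDiff

theorem hasDerivAt_pdx {f : ℝ × ℝ → ℝ} (hf : Differentiable ℝ f) (p : ℝ × ℝ) :
    HasDerivAt (fun x => f (x, p.2)) (pdx f p) p.1 :=
  ((hf (p.1, p.2)).comp p.1
    (differentiableAt_id.prodMk (differentiableAt_const p.2))).hasDerivAt

theorem hasDerivAt_pdt {f : ℝ × ℝ → ℝ} (hf : Differentiable ℝ f) (p : ℝ × ℝ) :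
    HasDerivAt (fun t => f (p.1, t)) (pdt f p) p.2 :=
  ((hf (p.1, p.2)).comp p.2
    ((differentiableAt_const p.1).prodMk differentiableAt_id)).hasDerivAt

theorem pdx_eq_fderiv {f : ℝ × ℝ → ℝ} (hf : Differentiable ℝ f) :
    pdx f = fun p => fderiv ℝ f p (1, 0) := by
  funext p
  exact ((hf p).hasFDerivAt.comp_hasDerivAt p.1
    ((hasDerivAt_id p.1).prodMk (hasDerivAt_const p.1 p.2))).deriv

theorem pdt_eq_fderiv {f : ℝ × ℝ → ℝ} (hf : Differentiable ℝ f) :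
    pdt f = fun p => fderiv ℝ f p (0, 1) := by
  funext p
  exact ((hf p).hasFDerivAt.comp_hasDerivAt p.2
    ((hasDerivAt_const p.2 p.1).prodMk (hasDerivAt_id p.2))).deriv

theorem contDiff_pdx {f : ℝ × ℝ → ℝ} (hf : ContDiff ℝ ∞ f) : ContDiff ℝ ∞ (pdx f) := by
  rw [pdx_eq_fderiv (hf.differentiable (by simp))]
  exact (hf.fderiv_right (m := ∞) (by simp)).clm_apply contDiff_const

theorem contDiff_pdt {f : ℝ × ℝ → ℝ} (hf : ContDiff ℝ ∞ f) : ContDiff ℝ ∞ (pdt f) := by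
  rw [pdt_eq_fderiv (hf.differentiable (by simp))]
  exact (hf.fderiv_right (m := ∞) (by simp)).clm_apply contDiff_const

/-- Mixed partial derivatives of a smooth function commute. -/
theorem pdt_pdx_comm {f : ℝ × ℝ → ℝ} (hf : ContDiff ℝ ∞ f) : pdt (pdx f) = pdx (pdt f) := by
  have hd : Differentiable ℝ f := hf.differentiable (by simp)
  have hd' : Differentiable ℝ (fderiv ℝ f) :=
    (hf.fderiv_right (m := ∞) (by simp)).differentiable (by simp)
  rw [pdt_eq_fderiv ((contDiff_pdx hf).differentiable (by simp)),
    pdx_eq_fderiv ((contDiff_pdt hf).differentiable (by simp)),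
    pdx_eq_fderiv hd, pdt_eq_fderiv hd]
  funext p
  have key := second_derivative_symmetric (fun y => (hd y).hasFDerivAt) (hd' p).hasFDerivAt
    (0, 1) (1, 0)
  rw [fderiv_clm_apply (hd' p) (differentiableAt_const _),
    fderiv_clm_apply (hd' p) (differentiableAt_const _)]
  simpa using key

/-- The Miura transformation `u = w_x − w²` maps solutions of the Fordy–Gibbons equation to
solutions of the Sawada–Kotera equation `u_t = u_xxxxx + 5uu_xxx + 5u_xu_xx + 5u²u_x`. -/
theorem fordy_gibbons_to_sawada_kotera
    (w u : ℝ × ℝ → ℝ) (hw : ContDiff ℝ (⊤ : ℕ∞) w)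
    (hFG : ∀ p : ℝ × ℝ,
      pdt w p = pdx (pdx (pdx (pdx (pdx w)))) p
        - 5 * pdx w p * pdx (pdx (pdx w)) p
        - 5 * (pdx (pdx w) p) ^ 2
        - 5 * (pdx w p) ^ 3
        - 20 * w p * pdx w p * pdx (pdx w) p
        - 5 * (w p) ^ 2 * pdx (pdx (pdx w)) p
        + 5 * (w p) ^ 4 * pdx w p)
    (hu : u = fun p => pdx w p - (w p) ^ 2) :
    ∀ p : ℝ × ℝ,
      pdt u p = pdx (pdx (pdx (pdx (pdx u)))) p
        + 5 * u p * pdx (pdx (pdx u)) p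
        + 5 * pdx u p * pdx (pdx u) p
        + 5 * (u p) ^ 2 * pdx u p := by
  have smooth {f : ℝ × ℝ → ℝ} (hf : ContDiff ℝ ∞ f) : Differentiable ℝ f :=
    hf.differentiable (by simp)
  have c1 := contDiff_pdx hw
  have c2 := contDiff_pdx c1
  have c3 := contDiff_pdx c2
  have c4 := contDiff_pdx c3
  have c5 := contDiff_pdx c4
  have dt0 := hasDerivAt_pdt (smooth hw)
  have dt1 := hasDerivAt_pdt (smooth c1)
  rw [pdt_pdx_comm hw, funext hFG] at dt1
  have d0 := hasDerivAt_pdx (smooth hw)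
  have d1 := hasDerivAt_pdx (smooth c1)
  have d2 := hasDerivAt_pdx (smooth c2)
  have d3 := hasDerivAt_pdx (smooth c3)
  have d4 := hasDerivAt_pdx (smooth c4)
  have d5 := hasDerivAt_pdx (smooth c5)
  generalize pdx (pdx (pdx (pdx (pdx (pdx w))))) = w6 at *
  generalize pdx (pdx (pdx (pdx (pdx w)))) = w5 at *
  generalize pdx (pdx (pdx (pdx w))) = w4 at *
  generalize pdx (pdx (pdx w)) = w3 at *
  generalize pdx (pdx w) = w2 at *
  generalize pdx w = w1 at *
  have u1 : pdx u = fun p => w2 p - 2 * w p * w1 p := by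
    subst hu
    funext p
    refine ((d1 p).sub ((d0 p).pow 2)).deriv.trans ?_
    ring
  have u2 : pdx (pdx u) = fun p => w3 p - 2 * w1 p ^ 2 - 2 * w p * w2 p := by
    rw [u1]
    funext p
    refine ((d2 p).sub (((d0 p).const_mul 2).mul (d1 p))).deriv.trans ?_
    ring
  have u3 : pdx (pdx (pdx u)) = fun p => w4 p - 6 * w1 p * w2 p - 2 * w p * w3 p := by
    rw [u2]
    funext p
    refine (((d3 p).sub (((d1 p).pow 2).const_mul 2)).sub
      (((d0 p).const_mul 2).mul (d2 p))).deriv.trans ?_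
    ring
  have u4 : pdx (pdx (pdx (pdx u))) =
      fun p => w5 p - 6 * w2 p ^ 2 - 8 * w1 p * w3 p - 2 * w p * w4 p := by
    rw [u3]
    funext p
    refine (((d4 p).sub (((d1 p).const_mul 6).mul (d2 p))).sub
      (((d0 p).const_mul 2).mul (d3 p))).deriv.trans ?_
    ring
  have u5 : pdx (pdx (pdx (pdx (pdx u)))) =
      fun p => w6 p - 20 * w2 p * w3 p - 10 * w1 p * w4 p - 2 * w p * w5 p := by
    rw [u4]
    funext p
    refine ((((d5 p).sub (((d2 p).pow 2).const_mul 6)).sub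
      (((d1 p).const_mul 8).mul (d3 p))).sub (((d0 p).const_mul 2).mul (d4 p))).deriv.trans ?_
    ring
  intro p
  have hx : pdx (fun p => w5 p - 5 * w1 p * w3 p - 5 * w2 p ^ 2 - 5 * w1 p ^ 3
      - 20 * w p * w1 p * w2 p - 5 * w p ^ 2 * w3 p + 5 * w p ^ 4 * w1 p) p = _ :=
    (((((((d5 p).sub (((d1 p).const_mul 5).mul (d3 p))).sub (((d2 p).pow 2).const_mul 5)).sub
      (((d1 p).pow 3).const_mul 5)).sub ((((d0 p).const_mul 20).mul (d1 p)).mul (d2 p))).sub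
      ((((d0 p).pow 2).const_mul 5).mul (d3 p))).add
      ((((d0 p).pow 4).const_mul 5).mul (d1 p))).deriv
  rw [u5, u3, u2, u1, hu]
  refine ((dt1 p).sub ((dt0 p).pow 2)).deriv.trans ?_
  rw [hx, hFG p]
  simp only [Pi.mul_apply, Pi.pow_apply]
  ring
end

section
/- Let u : ℝ × ℝ → ℝ be smooth, everywhere positive, and satisfy the Harry Dym equation u_t = −u³ u_xxx at every point. Let y : ℝ × ℝ → ℝ be smooth with ∂y/∂x = u⁻¹ and ∂y/∂t = u·u_xx − (1/2)·u_x² at every point, and let v : ℝ × ℝ → ℝ be a smooth function of (Y,τ) such that v(y(x,t), t) = −u_x(x,t) for all (x,t). Then at every point of the form (Y,τ) = (y(x,t), t), v satisfies the MKdV equation v_τ = −v_YYY + (3/2) v² v_Y. -/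
/-- Partial derivative with respect to the first variable. -/
noncomputable def pd1 (f : ℝ × ℝ → ℝ) : ℝ × ℝ → ℝ := fun p => deriv (fun x => f (x, p.2)) p.1

/-- Partial derivative with respect to the second variable. -/
noncomputable def pd2 (f : ℝ × ℝ → ℝ) : ℝ × ℝ → ℝ := fun p => deriv (fun t => f (p.1, t)) p.2

theorem pd1_eq_fderiv {f : ℝ × ℝ → ℝ} {p : ℝ × ℝ} (hf : DifferentiableAt ℝ f p) :
    pd1 f p = fderiv ℝ f p (1, 0) :=
  (HasFDerivAt.comp_hasDerivAt (f := fun x : ℝ => (x, p.2)) p.1 hf.hasFDerivAt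
    ((hasDerivAt_id p.1).prodMk (hasDerivAt_const p.1 p.2))).deriv

theorem pd2_eq_fderiv {f : ℝ × ℝ → ℝ} {p : ℝ × ℝ} (hf : DifferentiableAt ℝ f p) :
    pd2 f p = fderiv ℝ f p (0, 1) :=
  (HasFDerivAt.comp_hasDerivAt (f := fun t : ℝ => (p.1, t)) p.2 hf.hasFDerivAt
    ((hasDerivAt_const p.2 p.1).prodMk (hasDerivAt_id p.2))).deriv

theorem hasDerivAt_pd1 {f : ℝ × ℝ → ℝ} {p : ℝ × ℝ} (hf : DifferentiableAt ℝ f p) :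
    HasDerivAt (fun x => f (x, p.2)) (pd1 f p) p.1 := by
  rw [pd1_eq_fderiv hf]
  exact HasFDerivAt.comp_hasDerivAt (f := fun x : ℝ => (x, p.2)) p.1 hf.hasFDerivAt
    ((hasDerivAt_id p.1).prodMk (hasDerivAt_const p.1 p.2))

theorem ContDiff.pd1 {f : ℝ × ℝ → ℝ} (hf : ContDiff ℝ (⊤ : ℕ∞) f) :
    ContDiff ℝ (⊤ : ℕ∞) (pd1 f) := by
  have h : _root_.pd1 f = fun p => fderiv ℝ f p (1, 0) :=
    funext fun p => pd1_eq_fderiv (hf.differentiable (by simp) p)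
  rw [h]
  exact (hf.fderiv_right (m := (⊤ : ℕ∞)) (by simp)).clm_apply contDiff_const

/-- Chain rule in the first variable for `p ↦ w (y p, p.2)`. -/
theorem pd1_comp {w y : ℝ × ℝ → ℝ} {p : ℝ × ℝ} (hw : DifferentiableAt ℝ w (y p, p.2))
    (hy : DifferentiableAt ℝ y p) :
    pd1 (fun q => w (y q, q.2)) p = pd1 w (y p, p.2) * pd1 y p := by
  have hd : HasFDerivAt (fun q => w (y q, q.2)) _ p :=
    HasFDerivAt.comp p hw.hasFDerivAt (hy.hasFDerivAt.prodMk hasFDerivAt_snd)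
  rw [pd1_eq_fderiv hw, pd1_eq_fderiv hy, pd1_eq_fderiv hd.differentiableAt,
    hd.fderiv]
  have e : (fderiv ℝ y p (1, 0), (0 : ℝ)) = fderiv ℝ y p (1, 0) • ((1, 0) : ℝ × ℝ) := by simp
  simp only [ContinuousLinearMap.comp_apply, ContinuousLinearMap.prod_apply,
    ContinuousLinearMap.coe_snd']
  rw [e, map_smul, smul_eq_mul, mul_comm]

/-- Chain rule in the second variable for `p ↦ w (y p, p.2)`. -/
theorem pd2_comp {w y : ℝ × ℝ → ℝ} {p : ℝ × ℝ} (hw : DifferentiableAt ℝ w (y p, p.2))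
    (hy : DifferentiableAt ℝ y p) :
    pd2 (fun q => w (y q, q.2)) p = pd1 w (y p, p.2) * pd2 y p + pd2 w (y p, p.2) := by
  have hd : HasFDerivAt (fun q => w (y q, q.2)) _ p :=
    HasFDerivAt.comp p hw.hasFDerivAt (hy.hasFDerivAt.prodMk hasFDerivAt_snd)
  rw [pd1_eq_fderiv hw, pd2_eq_fderiv hw, pd2_eq_fderiv hy, pd2_eq_fderiv hd.differentiableAt,
    hd.fderiv]
  have e : (fderiv ℝ y p (0, 1), (1 : ℝ)) =
      fderiv ℝ y p (0, 1) • ((1, 0) : ℝ × ℝ) + (0, 1) := by simp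
  simp only [ContinuousLinearMap.comp_apply, ContinuousLinearMap.prod_apply,
    ContinuousLinearMap.coe_snd']
  rw [e, map_add, map_smul, smul_eq_mul, mul_comm]

/-- Symmetry of mixed partial derivatives. -/
theorem pd2_pd1_comm {f : ℝ × ℝ → ℝ} (hf : ContDiff ℝ (⊤ : ℕ∞) f) (p : ℝ × ℝ) :
    pd2 (pd1 f) p = pd1 (pd2 f) p := by
  have h1 : pd1 f = fun p => fderiv ℝ f p (1, 0) :=
    funext fun p => pd1_eq_fderiv (hf.differentiable (by simp) p)
  have h2 : pd2 f = fun p => fderiv ℝ f p (0, 1) :=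
    funext fun p => pd2_eq_fderiv (hf.differentiable (by simp) p)
  have hd : DifferentiableAt ℝ (fderiv ℝ f) p :=
    (hf.fderiv_right (m := (⊤ : ℕ∞)) (by simp)).differentiable (by simp) p
  have happ (c : ℝ × ℝ) := hd.hasFDerivAt.clm_apply (hasFDerivAt_const c p)
  rw [h1, h2, pd2_eq_fderiv (happ _).differentiableAt, pd1_eq_fderiv (happ _).differentiableAt,
    (happ _).fderiv, (happ _).fderiv]
  have hs : IsSymmSndFDerivAt ℝ f p := hf.contDiffAt.isSymmSndFDerivAt
    (by simpa using WithTop.coe_le_coe.2 (le_top (a := (2 : ℕ∞))))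
  simpa using hs (0, 1) (1, 0)

/-- The reciprocal link between the Harry Dym and MKdV equations: if `u > 0` solves
`u_t = −u³u_xxx`, and `y` satisfies `y_x = u⁻¹`, `y_t = uu_xx − (1/2)u_x²`, then the
function `v` with `v(y(x,t), t) = −u_x(x,t)` solves the MKdV equation
`v_τ = −v_yyy + (3/2)v²v_y` at every point `(y(x,t), t)`. -/
theorem harry_dym_reciprocal_to_mkdv
    (u y v : ℝ × ℝ → ℝ)
    (hu : ContDiff ℝ (⊤ : ℕ∞) u) (hupos : ∀ p, 0 < u p)
    (hHD : ∀ p : ℝ × ℝ, pd2 u p = -(u p) ^ 3 * pd1 (pd1 (pd1 u)) p)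
    (hy : ContDiff ℝ (⊤ : ℕ∞) y)
    (hyx : ∀ p : ℝ × ℝ, pd1 y p = (u p)⁻¹)
    (hyt : ∀ p : ℝ × ℝ, pd2 y p = u p * pd1 (pd1 u) p - (1 / 2) * (pd1 u p) ^ 2)
    (hv : ContDiff ℝ (⊤ : ℕ∞) v)
    (hcomp : ∀ p : ℝ × ℝ, v (y p, p.2) = -pd1 u p) :
    ∀ p : ℝ × ℝ,
      pd2 v (y p, p.2)
        = -pd1 (pd1 (pd1 v)) (y p, p.2)
          + (3 / 2) * (v (y p, p.2)) ^ 2 * pd1 v (y p, p.2) := by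
  have dif {f : ℝ × ℝ → ℝ} (hf : ContDiff ℝ (⊤ : ℕ∞) f) (q : ℝ × ℝ) : DifferentiableAt ℝ f q :=
    hf.differentiable (by simp) q
  -- `∂_y = u ∂_x` on functions of the form `q ↦ w (y q, q.2)`
  have chain {w g : ℝ × ℝ → ℝ} (hw : ContDiff ℝ (⊤ : ℕ∞) w) (hg : ∀ q, w (y q, q.2) = g q)
      (q : ℝ × ℝ) : pd1 w (y q, q.2) = u q * pd1 g q := by
    have h := pd1_comp (dif hw (y q, q.2)) (dif hy q)
    rw [funext hg, hyx] at h
    rw [h]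
    field_simp [(hupos q).ne']
  have d0 (q : ℝ × ℝ) := hasDerivAt_pd1 (dif hu q)
  have d1 (q : ℝ × ℝ) := hasDerivAt_pd1 (dif hu.pd1 q)
  have d2 (q : ℝ × ℝ) := hasDerivAt_pd1 (dif hu.pd1.pd1 q)
  have d3 (q : ℝ × ℝ) := hasDerivAt_pd1 (dif hu.pd1.pd1.pd1 q)
  have hv1 (q : ℝ × ℝ) : pd1 v (y q, q.2) = -(u q * pd1 (pd1 u) q) := by
    rw [chain hv hcomp q, show pd1 (fun q => -pd1 u q) q = _ from (d1 q).neg.deriv]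
    ring
  have hv2 (q : ℝ × ℝ) : pd1 (pd1 v) (y q, q.2) =
      -(u q * (pd1 u q * pd1 (pd1 u) q + u q * pd1 (pd1 (pd1 u)) q)) := by
    rw [chain hv.pd1 hv1 q, show pd1 (fun q => -(u q * pd1 (pd1 u) q)) q = _ from
      ((d0 q).mul (d2 q)).neg.deriv]
    ring
  intro p
  have hv3 := chain hv.pd1.pd1 hv2 p
  rw [show pd1 (fun q => -(u q * (pd1 u q * pd1 (pd1 u) q + u q * pd1 (pd1 (pd1 u)) q))) p = _
    from ((d0 p).fun_mul
      (((d1 p).fun_mul (d2 p)).fun_add ((d0 p).fun_mul (d3 p)))).fun_neg.deriv] at hv3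
  have ht := pd2_comp (dif hv (y p, p.2)) (dif hy p)
  have hneg : pd2 (fun q => -pd1 u q) p = -pd2 (pd1 u) p := deriv.fun_neg
  have hHDx : pd1 (fun q => -(u q) ^ 3 * pd1 (pd1 (pd1 u)) q) p = _ :=
    (((d0 p).fun_pow 3).fun_neg.fun_mul (d3 p)).deriv
  rw [funext hcomp, hneg, pd2_pd1_comm hu, funext hHD, hHDx, hv1, hyt] at ht
  rw [hv3, hcomp, hv1]
  simp at ht
  linear_combination -ht
end
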